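/- Let Λ ⊂ ℤⁿ be a finite set, let c ∈ ℂ^Λ be a nonzero coefficient vector with support exactly Λ, with associated trigonometric polynomial ψ and zero set S, and suppose ψ is irreducible and minimal for S. Assume 0 < H^{n−1}(S) < ∞ and let μ_S be the normalized (n−1)-dimensional Hausdorff measure on S. If N ≥ |Λ| − 1, then for μ_S^{⊗N}-almost every tuple (x₁, …, x_N) ∈ (ℝⁿ)^N, the feature matrix satisfies rank(Φ_Λ(x₁,…,x_N)) = |Λ| − 1. -/

import Mathlib

open Complex
open scoped Real

/-- The exponential feature map `φ_Λ : ℝⁿ → ℂ^Λ`, `(φ_Λ(x))_k = exp(2πi⟨k,x⟩)`. -/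
noncomputable def phiMap {n : ℕ} (Λ : Finset (Fin n → ℤ)) (x : Fin n → ℝ) : Λ → ℂ :=
  fun k => Complex.exp (2 * Real.pi * Complex.I * (∑ i, (k.1 i : ℝ) * x i))

/-- The `|Λ| × N` feature matrix whose `j`-th column is `φ_Λ(x_j)`. -/
noncomputable def featureMatrix {n : ℕ} {J : Type} [Fintype J] (Λ : Finset (Fin n → ℤ))
    (x : J → Fin n → ℝ) : Matrix Λ J ℂ :=
  Matrix.of fun k j => phiMap Λ (x j) k

/-- The trigonometric polynomial `ψ(x) = Σ_{k∈Λ} c_k exp(2πi⟨k,x⟩)`. -/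
noncomputable def trigPoly {n : ℕ} (Λ : Finset (Fin n → ℤ)) (c : Λ → ℂ) (x : Fin n → ℝ) : ℂ :=
  ∑ k, c k * phiMap Λ x k

/-- The zero set `S = {x ∈ [0,1)ⁿ : ψ(x) = 0}`. -/
def zeroSet {n : ℕ} (Λ : Finset (Fin n → ℤ)) (c : Λ → ℂ) : Set (Fin n → ℝ) :=
  {x | (∀ i, 0 ≤ x i ∧ x i < 1) ∧ trigPoly Λ c x = 0}

/-- The complex polynomial `P[ψ](z) = Σ_{k∈Λ} c_k z^{k−m}` associated with the trigonometric
polynomial with coefficients `c` on `Λ`, where `m` is the componentwise minimum of `Λ`. -/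
noncomputable def assocPoly {n : ℕ} (Λ : Finset (Fin n → ℤ)) (c : Λ → ℂ) (m : Fin n → ℤ) :
    MvPolynomial (Fin n) ℂ :=
  ∑ k : Λ, MvPolynomial.monomial (Finsupp.equivFunOnFinite.symm fun i => (k.1 i - m i).toNat) (c k)


section Elim
variable {R : Type*} [CommRing R] [IsDomain R]

lemma elim_aux (f g : Polynomial R) (hf : Prime f) (hg : ¬ f ∣ g) :
    ∃ r : R, r ≠ 0 ∧ ∃ a b : Polynomial R, Polynomial.C r = a * f + b * g := by
  have : IsDomain (AdjoinRoot f) := AdjoinRoot.isDomain_of_prime hf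
  have hroot := AdjoinRoot.isAlgebraic_root (f := f) hf.ne_zero
  have halg : IsAlgebraic R (AdjoinRoot.mk f g) := by
    have h1 := (Algebra.isAlgebraic_adjoin_iff (R := R) (S := AdjoinRoot f)
      (s := {AdjoinRoot.root f})).2 (by simpa using hroot)
    apply h1
    rw [AdjoinRoot.adjoinRoot_eq_top]; trivial
  have hne : AdjoinRoot.mk f g ≠ 0 := by
    rwa [Ne, AdjoinRoot.mk_eq_zero]
  obtain ⟨r, hr, hd⟩ := halg.exists_nonzero_dvd (mem_nonZeroDivisors_of_ne_zero hne)
  obtain ⟨h, hh⟩ := hd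
  obtain ⟨b, rfl⟩ := AdjoinRoot.mk_surjective h
  refine ⟨r, hr, ?_⟩
  have : AdjoinRoot.mk f (Polynomial.C r - g * b) = 0 := by
    rw [map_sub, map_mul, ← hh, AdjoinRoot.mk_C, AdjoinRoot.algebraMap_eq, sub_self]
  rw [AdjoinRoot.mk_eq_zero] at this
  obtain ⟨a, ha⟩ := this
  exact ⟨a, b, by linear_combination ha⟩
end Elim

lemma elim_mv {m : ℕ} (i : Fin (m+1)) (f g : MvPolynomial (Fin (m+1)) ℂ) (hf : Prime f)
    (hg : ¬ f ∣ g) :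
    ∃ r : MvPolynomial (Fin m) ℂ, r ≠ 0 ∧ ∀ z : Fin (m+1) → ℂ, MvPolynomial.eval z f = 0 →
      MvPolynomial.eval z g = 0 → MvPolynomial.eval (i.removeNth z) r = 0 := by
  let Φ := (MvPolynomial.renameEquiv ℂ (finSuccEquiv' i)).trans
    (MvPolynomial.optionEquivLeft ℂ (Fin m))
  have hΦ : ∀ p (z : Fin (m+1) → ℂ), MvPolynomial.eval z p =
      Polynomial.eval (z i) (Polynomial.map (MvPolynomial.eval (i.removeNth z)) (Φ p)) := by
    intro p z
    simp only [Φ, AlgEquiv.trans_apply]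
    rw [← MvPolynomial.optionEquivLeft_elim_eval, MvPolynomial.renameEquiv_apply,
      MvPolynomial.eval_rename]
    congr 1
    congr 1
    funext j
    rcases Fin.eq_self_or_eq_succAbove i j with rfl | ⟨k, rfl⟩
    · simp
    · simp [Fin.removeNth]
  obtain ⟨r, hr, a, b, hab⟩ := elim_aux (Φ f) (Φ g)
    ((MulEquiv.prime_iff Φ.toMulEquiv).2 hf) (by
      intro h; exact hg ((map_dvd_iff Φ).1 h))
  refine ⟨r, hr, fun z h1 h2 => ?_⟩
  rw [hΦ] at h1 h2
  have := congrArg (fun p => Polynomial.eval (z i)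
    (Polynomial.map (MvPolynomial.eval (i.removeNth z)) p)) hab
  simpa [h1, h2] using this

lemma exists_pderiv {σ : Type*} (p : MvPolynomial σ ℂ) (h : ∀ i, MvPolynomial.pderiv i p = 0) :
    p = MvPolynomial.C (MvPolynomial.coeff 0 p) := by
  classical
  ext k
  rw [MvPolynomial.coeff_C]
  split_ifs with hk
  · rw [hk]
  · obtain ⟨i, hi⟩ : ∃ i, k i ≠ 0 := by
      by_contra hcon; push Not at hcon; exact hk (by ext i; simp [hcon i])
    have h1 := congrArg (MvPolynomial.coeff (k - Finsupp.single i 1)) (h i)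
    rw [MvPolynomial.coeff_pderiv] at h1
    have h2 : k - Finsupp.single i 1 + Finsupp.single i 1 = k := by
      apply tsub_add_cancel_of_le
      rw [Finsupp.single_le_iff]; omega
    rw [h2, MvPolynomial.coeff_zero] at h1
    rcases mul_eq_zero.1 h1 with h1 | h1
    · exact h1
    · exfalso
      exact (Nat.cast_add_one_ne_zero _) h1

lemma totalDegree_pderiv_le' {σ : Type*} (p : MvPolynomial σ ℂ) (D : ℕ) (hp : p.totalDegree ≤ D+1)
    (i : σ) : (MvPolynomial.pderiv i p).totalDegree ≤ D := by
  classical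
  apply Finset.sup_le
  intro k hk
  rw [MvPolynomial.mem_support_iff, MvPolynomial.coeff_pderiv] at hk
  have h1 := MvPolynomial.le_totalDegree (MvPolynomial.mem_support_iff.2 (left_ne_zero_of_mul hk))
  rw [Finsupp.sum_add_index' (by simp) (by simp)] at h1
  simp at h1
  simp
  omega

/-- exponential torus map -/
noncomputable def tor {ι : Type*} (x : ι → ℝ) : ι → ℂ := fun i => Complex.exp (2 * π * I * x i)

lemma tor_ne {ι : Type*} (x : ι → ℝ) (i) : tor x i ≠ 0 := Complex.exp_ne_zero _

lemma tor_strict {n : ℕ} (x : Fin n → ℝ) (i : Fin n) :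
    HasStrictFDerivAt (fun x : Fin n → ℝ => tor x i)
     ((2 * π * I * tor x i) • (Complex.ofRealCLM.comp (ContinuousLinearMap.proj (R := ℝ) (φ := fun _ : Fin n => ℝ) i))) x := by
  have h1 : HasStrictFDerivAt (fun x : Fin n → ℝ => (x i : ℂ)) (Complex.ofRealCLM.comp (ContinuousLinearMap.proj (R := ℝ) (φ := fun _ : Fin n => ℝ) i)) x :=
    (Complex.ofRealCLM.comp (ContinuousLinearMap.proj (R := ℝ) (φ := fun _ : Fin n => ℝ) i)).hasStrictFDerivAt
  have h2 := (h1.const_mul (2 * π * I)).cexp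
  have heq : ((2 * π * I * tor x i) • (Complex.ofRealCLM.comp (ContinuousLinearMap.proj (R := ℝ) (φ := fun _ : Fin n => ℝ) i))) = Complex.exp (2 * π * I * x i) • (2 * π * I) • (Complex.ofRealCLM.comp (ContinuousLinearMap.proj (R := ℝ) (φ := fun _ : Fin n => ℝ) i)) := by
    rw [smul_smul, mul_comm]; rfl
  rw [heq]
  exact h2

lemma eval_strict {n : ℕ} (p : MvPolynomial (Fin n) ℂ) (x : Fin n → ℝ) :
    ∃ L : (Fin n → ℝ) →L[ℝ] ℂ, HasStrictFDerivAt (fun x => MvPolynomial.eval (tor x) p) L x ∧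
      ∀ i, L (Pi.single i 1) = 2 * π * I * tor x i * MvPolynomial.eval (tor x) (MvPolynomial.pderiv i p) := by
  induction p using MvPolynomial.induction_on with
  | C a => exact ⟨0, by simpa using hasStrictFDerivAt_const _ _, by simp⟩
  | add p q hp hq =>
    obtain ⟨L, h1, h2⟩ := hp
    obtain ⟨M, h3, h4⟩ := hq
    refine ⟨L + M, by simp only [map_add]; exact h1.add h3, fun i => ?_⟩
    simp [h2, h4]; ring
  | mul_X p j hp =>
    obtain ⟨L, h1, h2⟩ := hp
    refine ⟨_, by simp only [map_mul, MvPolynomial.eval_X]; exact h1.mul (tor_strict x j), fun i => ?_⟩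
    by_cases hij : i = j
    · subst hij
      simp [h2]
      ring
    · simp [h2, MvPolynomial.pderiv_X_of_ne (Ne.symm hij), Pi.single_eq_of_ne (Ne.symm hij)]
      ring

section Aux
open MeasureTheory Set Topology

lemma key_est {n : ℕ} (L : (Fin n → ℝ) →L[ℝ] ℂ) (i : Fin n) (hne : L (Pi.single i 1) ≠ 0)
    (x y : Fin n → ℝ) (h1 : ‖L (x - y)‖ ≤ ‖L (Pi.single i 1)‖ / 2 * ‖x - y‖) :
    dist x y ≤ (2 * ‖L‖ / ‖L (Pi.single i 1)‖ + 1) *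
      dist (Function.update x i 0) (Function.update y i 0) := by
  set a := ‖L (Pi.single i 1)‖ with ha
  have ha0 : 0 < a := norm_pos_iff.2 hne
  have h2 : x - y = (x i - y i) • Pi.single i (1:ℝ) + (Function.update x i 0 - Function.update y i 0) := by
    funext j
    by_cases hj : j = i
    · subst hj; simp
    · simp [hj]
  have h3 : |x i - y i| * a ≤ ‖L (x - y)‖ + ‖L‖ * ‖Function.update x i 0 - Function.update y i 0‖ := by
    have : (x i - y i) • L (Pi.single i (1:ℝ)) = L (x - y) - L (Function.update x i 0 - Function.update y i 0) := by
      rw [h2, map_add, map_smul]; simp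
    calc |x i - y i| * a = ‖(x i - y i) • L (Pi.single i (1:ℝ))‖ := by
          rw [norm_smul, Real.norm_eq_abs]
      _ ≤ _ := by
        rw [this]
        exact (norm_sub_le _ _).trans (by gcongr; exact L.le_opNorm _)
  have h4 : ‖x - y‖ ≤ max |x i - y i| ‖Function.update x i 0 - Function.update y i 0‖ := by
    rw [pi_norm_le_iff_of_nonneg (by positivity)]
    intro j
    by_cases hj : j = i
    · subst hj; exact le_max_left _ _
    · refine le_trans ?_ (le_max_right _ _)
      have := norm_le_pi_norm (Function.update x i 0 - Function.update y i 0) j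
      simpa [hj] using this
  rw [dist_eq_norm, dist_eq_norm]
  have h5 : 0 ≤ ‖Function.update x i 0 - Function.update y i 0‖ := norm_nonneg _
  have h6 : 0 ≤ ‖L‖ := norm_nonneg _
  rcases le_total |x i - y i| ‖Function.update x i 0 - Function.update y i 0‖ with hc | hc
  · rw [max_eq_right hc] at h4
    have : 0 ≤ 2 * ‖L‖ / a * ‖Function.update x i 0 - Function.update y i 0‖ := by positivity
    linarith
  · rw [max_eq_left hc] at h4
    have h7 : ‖x - y‖ * a ≤ 2 * ‖L‖ * ‖Function.update x i 0 - Function.update y i 0‖ := by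
      nlinarith [mul_le_mul_of_nonneg_right h4 ha0.le]
    have h8 : ‖x - y‖ ≤ 2 * ‖L‖ * ‖Function.update x i 0 - Function.update y i 0‖ / a := by
      rwa [le_div_iff₀ ha0]
    have h9 : 2 * ‖L‖ * ‖Function.update x i 0 - Function.update y i 0‖ / a = 2 * ‖L‖ / a * ‖Function.update x i 0 - Function.update y i 0‖ := by ring
    linarith

lemma null_of_key {X : Type*} [MetricSpace X] [MeasurableSpace X] [BorelSpace X] [Nonempty X]
    {d : ℝ} (hd : 0 ≤ d) (P : X → X) (s : Set X) (C : ℝ) (hC : 0 ≤ C)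
    (key : ∀ x ∈ s, ∀ y ∈ s, dist x y ≤ C * dist (P x) (P y)) (h2 : μH[d] (P '' s) = 0) :
    μH[d] s = 0 := by
  have hinj : InjOn P s := by
    intro x hx y hy hxy
    have := key x hx y hy
    rw [hxy, dist_self, mul_zero] at this
    exact dist_le_zero.1 this
  have hlip : LipschitzOnWith ⟨C, hC⟩ (Function.invFunOn P s) (P '' s) := by
    apply LipschitzOnWith.of_dist_le_mul
    rintro _ ⟨x, hx, rfl⟩ _ ⟨y, hy, rfl⟩
    rw [hinj.leftInvOn_invFunOn hx, hinj.leftInvOn_invFunOn hy]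
    exact key x hx y hy
  have h1 := hlip.hausdorffMeasure_image_le hd
  rw [hinj.leftInvOn_invFunOn.image_image] at h1
  rw [h2, mul_zero] at h1
  exact le_antisymm h1 zero_le

lemma strict_nhds {n : ℕ} (F : (Fin n → ℝ) → ℂ) (L : (Fin n → ℝ) →L[ℝ] ℂ) (x0 : Fin n → ℝ)
    (hL : HasStrictFDerivAt F L x0) (a : ℝ) (ha0 : 0 < a) :
    ∃ U ∈ 𝓝 x0, ∀ x ∈ U, ∀ y ∈ U, ‖F x - F y - L (x - y)‖ ≤ a / 2 * ‖x - y‖ := by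
  have hev := hL.isLittleO.def (half_pos ha0)
  rw [nhds_prod_eq] at hev
  obtain ⟨U, hU, hUL'⟩ := Filter.mem_prod_same_iff.1 hev
  exact ⟨U, hU, fun x hx y hy => hUL' (mk_mem_prod hx hy)⟩

lemma piece_null {n : ℕ} {d : ℝ} (hd : 0 ≤ d) (p : MvPolynomial (Fin n) ℂ) (i : Fin n)
    (T : Set (Fin n → ℝ))
    (hT : ∀ x ∈ T, MvPolynomial.eval (tor x) p = 0)
    (hT' : ∀ x ∈ T, MvPolynomial.eval (tor x) (MvPolynomial.pderiv i p) ≠ 0)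
    (hpi : μH[d] ((fun x : Fin n → ℝ => Function.update x i 0) '' T) = 0) :
    μH[d] T = 0 := by
  refine measure_null_of_locally_null T (fun x0 hx0 => ?_)
  obtain ⟨L, hL, hLi⟩ := eval_strict p x0
  have hne : L (Pi.single i 1) ≠ 0 := by
    rw [hLi]
    refine mul_ne_zero (mul_ne_zero (by simp [Real.pi_ne_zero]) (tor_ne _ _)) (hT' _ hx0)
  obtain ⟨U, hU, hUL⟩ := strict_nhds _ L x0 hL _ (norm_pos_iff.2 hne)
  refine ⟨T ∩ U, inter_mem_nhdsWithin _ hU, ?_⟩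
  refine null_of_key hd (fun x : Fin n → ℝ => Function.update x i 0) (T ∩ U)
    (2 * ‖L‖ / ‖L (Pi.single i 1)‖ + 1) (by positivity) ?_
    (measure_mono_null (image_mono inter_subset_left) hpi)
  intro x hx y hy
  have h1 := hUL x hx.2 y hy.2
  rw [hT x hx.1, hT y hy.1, sub_self, zero_sub, norm_neg] at h1
  exact key_est L i hne x y h1

lemma zero_null {n : ℕ} {d : ℝ} (hd : 0 ≤ d) (D : ℕ) (p : MvPolynomial (Fin n) ℂ) (hp : p ≠ 0)
    (hD : p.totalDegree ≤ D) (T : Set (Fin n → ℝ))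
    (hT : ∀ x ∈ T, MvPolynomial.eval (tor x) p = 0)
    (hpi : ∀ i, μH[d] ((fun x : Fin n → ℝ => Function.update x i 0) '' T) = 0) :
    μH[d] T = 0 := by
  induction D generalizing p T with
  | zero =>
    have h := MvPolynomial.totalDegree_eq_zero_iff_eq_C.1 (Nat.le_zero.1 hD)
    have : T = ∅ := by
      rw [eq_empty_iff_forall_notMem]
      intro x hx
      have h1 := hT x hx
      rw [h, MvPolynomial.eval_C] at h1
      rw [h1] at h
      exact hp (by simpa using h)
    simp [this]
  | succ D ih =>
    by_cases hc : ∀ i, MvPolynomial.pderiv i p = 0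
    · have h := exists_pderiv p hc
      have : T = ∅ := by
        rw [eq_empty_iff_forall_notMem]
        intro x hx
        have h1 := hT x hx
        rw [h, MvPolynomial.eval_C] at h1
        rw [h1] at h
        exact hp (by simpa using h)
      simp [this]
    · push Not at hc
      obtain ⟨i, hi⟩ := hc
      have h1 : μH[d] {x ∈ T | MvPolynomial.eval (tor x) (MvPolynomial.pderiv i p) = 0} = 0 :=
        ih _ hi (totalDegree_pderiv_le' p D hD i) _ (fun x hx => hx.2)
          (fun j => measure_mono_null (image_mono (sep_subset _ _)) (hpi j))
      have h2 : μH[d] {x ∈ T | MvPolynomial.eval (tor x) (MvPolynomial.pderiv i p) ≠ 0} = 0 :=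
        piece_null hd p i _ (fun x hx => hT x hx.1) (fun x hx => hx.2)
          (measure_mono_null (image_mono (sep_subset _ _)) (hpi i))
      refine measure_mono_null ?_ (measure_union_null h1 h2)
      intro x hx
      by_cases h : MvPolynomial.eval (tor x) (MvPolynomial.pderiv i p) = 0
      · exact Or.inl ⟨hx, h⟩
      · exact Or.inr ⟨hx, h⟩

lemma volume_null {n : ℕ} (p : MvPolynomial (Fin n) ℂ) (hp : p ≠ 0) :
    μH[(n:ℝ)] {x : Fin n → ℝ | MvPolynomial.eval (tor x) p = 0} = 0 := by
  apply zero_null (Nat.cast_nonneg n) _ p hp le_rfl _ (fun x hx => hx)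
  intro i
  have h : (μH[(n:ℝ)] : Measure (Fin n → ℝ)) = volume := by
    have := hausdorffMeasure_pi_real (ι := Fin n)
    simpa using this
  rw [h]
  refine measure_mono_null (t := {x : Fin n → ℝ | x i = 0}) ?_ ?_
  · rintro _ ⟨x, _, rfl⟩
    simp
  · exact Measure.pi_hyperplane (fun _ => volume) i 0

lemma codim_two {m : ℕ} (f g : MvPolynomial (Fin (m+1)) ℂ) (hf : Prime f) (hg : ¬ f ∣ g) :
    μH[(m:ℝ)] {x : Fin (m+1) → ℝ | MvPolynomial.eval (tor x) f = 0 ∧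
      MvPolynomial.eval (tor x) g = 0} = 0 := by
  apply zero_null (Nat.cast_nonneg m) _ f hf.ne_zero le_rfl _ (fun x hx => hx.1)
  intro i
  obtain ⟨r, hr, hrz⟩ := elim_mv i f g hf hg
  have hiso : Isometry (fun y : Fin m → ℝ => (i.insertNth (0:ℝ) y : Fin (m+1) → ℝ)) := by
    apply Isometry.of_dist_eq
    intro x y
    simp [Fin.dist_insertNth_insertNth]
  have h1 := hiso.hausdorffMeasure_image (d := (m:ℝ)) (Or.inl (Nat.cast_nonneg m))
    {x : Fin m → ℝ | MvPolynomial.eval (tor x) r = 0}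
  rw [volume_null r hr] at h1
  refine measure_mono_null ?_ h1
  rintro _ ⟨x, hx, rfl⟩
  have h2 : tor (i.removeNth x) = i.removeNth (tor x) := rfl
  refine ⟨i.removeNth x, ?_, ?_⟩
  · rw [mem_ofPred_eq, h2]
    exact hrz _ hx.1 hx.2
  · exact Fin.insertNth_removeNth i (0:ℝ) x

lemma trig_eval {n : ℕ} (Λ : Finset (Fin n → ℤ)) (c : Λ → ℂ) (m : Fin n → ℤ)
    (hm : ∀ k ∈ Λ, ∀ i, m i ≤ k i) (x : Fin n → ℝ) :
    trigPoly Λ c x = Complex.exp (2 * π * I * (∑ i, (m i : ℝ) * x i : ℝ)) *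
      MvPolynomial.eval (tor x) (assocPoly Λ c m) := by
  unfold trigPoly assocPoly
  rw [map_sum, Finset.mul_sum]
  refine Finset.sum_congr rfl fun k _ => ?_
  rw [MvPolynomial.eval_monomial, mul_left_comm]
  congr 1
  rw [Finsupp.prod_fintype _ _ (by simp)]
  have h1 : ∀ i, tor x i ^ (Finsupp.equivFunOnFinite.symm fun i => (k.1 i - m i).toNat) i =
      Complex.exp (2 * π * I * (((k.1 i - m i : ℤ) : ℂ) * x i)) := by
    intro i
    rw [tor, ← Complex.exp_nat_mul]
    congr 1
    have : (((k.1 i - m i).toNat : ℕ) : ℂ) = ((k.1 i - m i : ℤ) : ℂ) := by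
      have h2 : (((k.1 i - m i).toNat : ℕ) : ℤ) = k.1 i - m i :=
        Int.toNat_of_nonneg (sub_nonneg.2 (hm k k.2 i))
      exact_mod_cast congrArg (Int.cast : ℤ → ℂ) h2
    rw [Finsupp.equivFunOnFinite_symm_apply_apply, this]
    ring
  simp_rw [h1]
  rw [← Complex.exp_sum, ← Complex.exp_add, phiMap]
  congr 1
  push_cast
  rw [← Finset.mul_sum, ← mul_add, ← Finset.sum_add_distrib]
  congr 1
  refine Finset.sum_congr rfl fun i _ => ?_
  ring

lemma assoc_coeff {n : ℕ} (Λ : Finset (Fin n → ℤ)) (c : Λ → ℂ) (m : Fin n → ℤ)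
    (hm : ∀ k ∈ Λ, ∀ i, m i ≤ k i) (k : Λ) :
    MvPolynomial.coeff (Finsupp.equivFunOnFinite.symm fun i => (k.1 i - m i).toNat)
      (assocPoly Λ c m) = c k := by
  classical
  unfold assocPoly
  rw [MvPolynomial.coeff_sum, Finset.sum_eq_single k]
  · simp
  · intro l _ hl
    rw [MvPolynomial.coeff_monomial, if_neg]
    intro h
    apply hl
    ext i
    have := DFunLike.congr_fun h i
    simp only [Finsupp.equivFunOnFinite_symm_apply_apply] at this
    have h1 := hm k k.2 i
    have h2 := hm l l.2 i
    omega
  · simp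

lemma not_dvd_aux {n : ℕ} (Λ : Finset (Fin n → ℤ)) (c q : Λ → ℂ) (m : Fin n → ℤ)
    (hfull : ∀ k : Λ, c k ≠ 0)
    (hm : ∀ k ∈ Λ, ∀ i, m i ≤ k i) (hq : ∀ a : ℂ, q ≠ a • c) :
    ¬ assocPoly Λ c m ∣ assocPoly Λ q m := by
  classical
  rintro ⟨h, hh⟩
  have hg : assocPoly Λ q m ≠ 0 := by
    intro h0
    apply hq 0
    funext k
    rw [← assoc_coeff Λ q m hm k, h0]; simp
  have hf0 : assocPoly Λ c m ≠ 0 := left_ne_zero_of_mul (hh ▸ hg)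
  have hh0 : h ≠ 0 := right_ne_zero_of_mul (hh ▸ hg)
  have hdeg : ∀ i, h.degreeOf i = 0 := by
    intro i
    have h1 : (assocPoly Λ q m).degreeOf i ≤ (assocPoly Λ c m).degreeOf i := by
      unfold assocPoly
      rw [← assocPoly]
      refine (MvPolynomial.degreeOf_sum_le i _ _).trans (Finset.sup_le fun k _ => ?_)
      rw [← assocPoly]
      have h2 := MvPolynomial.monomial_le_degreeOf i
        (MvPolynomial.mem_support_iff.2 (by rw [assoc_coeff Λ c m hm k]; exact hfull k))
      refine le_trans ?_ h2
      by_cases hz : q k = 0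
      · simp [hz]
      · rw [MvPolynomial.degreeOf_monomial_eq _ _ hz]
    rw [hh, MvPolynomial.degreeOf_mul_eq hf0 hh0] at h1
    omega
  have hC : h = MvPolynomial.C (MvPolynomial.coeff 0 h) := by
    ext k
    rw [MvPolynomial.coeff_C]
    split_ifs with hk
    · rw [hk]
    · by_contra hne
      apply hk
      ext i
      have := MvPolynomial.monomial_le_degreeOf i (MvPolynomial.mem_support_iff.2 hne)
      rw [hdeg i] at this
      simp; omega
  apply hq (MvPolynomial.coeff 0 h)
  funext k
  rw [← assoc_coeff Λ q m hm k, hh, hC, mul_comm, MvPolynomial.coeff_C_mul,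
    assoc_coeff Λ c m hm k]
  simp

lemma geom {n : ℕ} (hn : 1 ≤ n) (Λ : Finset (Fin n → ℤ)) (c q : Λ → ℂ) (m : Fin n → ℤ)
    (hfull : ∀ k : Λ, c k ≠ 0)
    (hm : ∀ k ∈ Λ, ∀ i, m i ≤ k i) (hirr : Irreducible (assocPoly Λ c m))
    (hq : ∀ a : ℂ, q ≠ a • c) :
    μH[(n:ℝ) - 1] {x | x ∈ zeroSet Λ c ∧ trigPoly Λ q x = 0} = 0 := by
  obtain ⟨n, rfl⟩ : ∃ k, n = k + 1 := ⟨n - 1, by omega⟩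
  have h := codim_two _ _ hirr.prime (not_dvd_aux Λ c q m hfull hm hq)
  rw [show ((n + 1 : ℕ) : ℝ) - 1 = n by push_cast; ring]
  refine measure_mono_null ?_ h
  rintro x ⟨⟨_, h1⟩, h2⟩
  rw [trig_eval Λ _ m hm] at h1 h2
  exact ⟨(mul_eq_zero.1 h1).resolve_left (Complex.exp_ne_zero _),
    (mul_eq_zero.1 h2).resolve_left (Complex.exp_ne_zero _)⟩

lemma ae_prod_swap' {α β : Type*} [MeasurableSpace α] [MeasurableSpace β] {μ : Measure α}
    {ν : Measure β} [SFinite μ] [SFinite ν] {p : α × β → Prop} (hp : MeasurableSet {z | p z})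
    (h : ∀ᵐ y ∂ν, ∀ᵐ x ∂μ, p (x, y)) : ∀ᵐ z ∂μ.prod ν, p z := by
  rw [Measure.ae_prod_iff_ae_ae hp]
  exact (Measure.ae_ae_comm (p := fun x y => p (x, y)) hp).2 h

lemma ae_li {X V : Type*} [TopologicalSpace X] [SecondCountableTopology X] [MeasurableSpace X]
    [BorelSpace X] [NormedAddCommGroup V] [NormedSpace ℂ V]
    (φ : X → V) (hφ : Continuous φ) (μ : Measure X) [SigmaFinite μ] (r : ℕ)
    (H : ∀ U : Submodule ℂ V, Module.finrank ℂ U < r → FiniteDimensional ℂ U → ∀ᵐ y ∂μ, φ y ∉ U)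
    (j : ℕ) (hj : j ≤ r) :
    ∀ᵐ x ∂(Measure.pi fun _ : Fin j => μ), LinearIndependent ℂ (fun i => φ (x i)) := by
  induction j with
  | zero => exact Filter.Eventually.of_forall fun x => linearIndependent_empty_type
  | succ j ih =>
    have ih := ih (by omega)
    have hmp := measurePreserving_piFinSuccAbove (fun _ : Fin (j+1) => μ) 0
    have hopen : IsOpen {z : X × (Fin j → X) |
        LinearIndependent ℂ (Fin.cons (φ z.1) (fun i => φ (z.2 i)) : Fin (j+1) → V)} := by
      refine (isOpen_setOfPred_linearIndependent (𝕜 := ℂ) (E := V) (ι := Fin (j+1))).preimage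
        (f := fun z : X × (Fin j → X) => (Fin.cons (φ z.1) (fun i => φ (z.2 i)) : Fin (j+1) → V)) ?_
      apply continuous_pi
      intro i
      refine Fin.cases ?_ (fun i => ?_) i
      · exact hφ.comp continuous_fst
      · exact hφ.comp ((continuous_apply i).comp continuous_snd)
    have h1 : ∀ᵐ z ∂(μ.prod (Measure.pi fun _ : Fin j => μ)),
        LinearIndependent ℂ (Fin.cons (φ z.1) (fun i => φ (z.2 i)) : Fin (j+1) → V) := by
      refine ae_prod_swap' hopen.measurableSet ?_
      filter_upwards [ih] with x hx
      have hfr : Module.finrank ℂ (Submodule.span ℂ (range fun i => φ (x i))) < r := by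
        rw [finrank_span_eq_card hx]; simp; omega
      filter_upwards [H _ hfr (FiniteDimensional.span_of_finite ℂ (finite_range _))] with y hy
      rw [linearIndependent_finCons]
      exact ⟨hx, hy⟩
    have h2 := hmp.quasiMeasurePreserving.ae h1
    filter_upwards [h2] with x hx
    convert! hx using 1
    funext i
    refine Fin.cases ?_ (fun i => ?_) i
    · simp [MeasurableEquiv.piFinSuccAbove]
    · simp [MeasurableEquiv.piFinSuccAbove, Fin.tail]

lemma ae_extend {X : Type*} [MeasurableSpace X] (μ : Measure X) [SigmaFinite μ] (M N : ℕ)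
    (h : M ≤ N) (P : (Fin M → X) → Prop) (hP : ∀ᵐ x ∂(Measure.pi fun _ : Fin M => μ), P x) :
    ∃ e : Fin M → Fin N, ∀ᵐ x ∂(Measure.pi fun _ : Fin N => μ), P (fun i => x (e i)) := by
  induction N, h using Nat.le_induction with
  | base => exact ⟨id, hP⟩
  | succ N _ ih =>
    obtain ⟨e, he⟩ := ih
    refine ⟨fun i => (e i).succ, ?_⟩
    have hmp := measurePreserving_piFinSuccAbove (fun _ : Fin (N+1) => μ) 0
    have h1 := (Measure.quasiMeasurePreserving_snd (μ := μ)
      (ν := Measure.pi fun _ : Fin N => μ)).ae he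
    have h2 := hmp.quasiMeasurePreserving.ae h1
    filter_upwards [h2] with x hx
    exact hx

lemma phi_continuous {n : ℕ} (Λ : Finset (Fin n → ℤ)) : Continuous (phiMap Λ) := by
  apply continuous_pi
  intro k
  unfold phiMap
  fun_prop

lemma exists_ann {Λ : Type*} [Fintype Λ] (U : Submodule ℂ (Λ → ℂ)) (c : Λ → ℂ)
    (hU : Module.finrank ℂ U + 1 < Fintype.card Λ) :
    ∃ q : Λ → ℂ, (∀ a : ℂ, q ≠ a • c) ∧ ∀ v ∈ U, ∑ k, q k * v k = 0 := by
  classical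
  have h1 := Subspace.finrank_add_finrank_dualAnnihilator_eq U
  rw [Module.finrank_fintype_fun_eq_card] at h1
  let e : (Λ → ℂ) ≃ₗ[ℂ] Module.Dual ℂ (Λ → ℂ) := (Pi.basisFun ℂ Λ).toDualEquiv
  have he : ∀ q v, e q v = ∑ k, q k * v k := by
    intro q v
    have hv : v = ∑ k, v k • Pi.basisFun ℂ Λ k := by
      funext l; simp [Pi.single_apply]
    have hq : q = ∑ k, q k • Pi.basisFun ℂ Λ k := by
      funext l; simp [Pi.single_apply]
    conv_lhs => rw [hv, hq]
    simp only [map_sum, map_smul, LinearMap.sum_apply, LinearMap.smul_apply, e,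
      Module.Basis.toDualEquiv_apply, Module.Basis.toDual_apply, smul_eq_mul]
    simp [mul_comm]
  by_contra hcon
  push Not at hcon
  have hle : U.dualAnnihilator ≤ Submodule.span ℂ {e c} := by
    intro w hw
    rw [Submodule.mem_span_singleton]
    by_contra hne
    push Not at hne
    obtain ⟨v, hv, hv2⟩ := hcon (e.symm w) (fun a ha => hne a (by
      rw [← map_smul, ← ha, LinearEquiv.apply_symm_apply]))
    apply hv2
    rw [← he, LinearEquiv.apply_symm_apply]
    exact (Submodule.mem_dualAnnihilator w).1 hw v hv
  have h2 := Submodule.finrank_mono hle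
  have h3 := finrank_span_le_card (R := ℂ) ({e c} : Set (Module.Dual ℂ (Λ → ℂ)))
  simp only [toFinset_singleton, Finset.card_singleton] at h3
  omega

end Aux

open MeasureTheory in
/-- Let `ψ` (coefficients `c`, support exactly `Λ`) be irreducible and
minimal for its zero set `S`, with `0 < H^{n−1}(S) < ∞`, and let `μ_S` be the normalized
`(n−1)`-dimensional Hausdorff measure on `S`.  If `N ≥ |Λ| − 1`, then for
`μ_S^{⊗N}`-almost every tuple `(x₁,…,x_N)`, `rank Φ_Λ(x₁,…,x_N) = |Λ| − 1`. -/
theorem statement3 {n N : ℕ} (hn : 1 ≤ n) (Λ : Finset (Fin n → ℤ)) (c : Λ → ℂ) (hc : c ≠ 0)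
    (hfull : ∀ k : Λ, c k ≠ 0)
    -- irreducibility of ψ (via the associated complex polynomial, `m` the componentwise min)
    (m : Fin n → ℤ)
    (hm_lb : ∀ k ∈ Λ, ∀ i, m i ≤ k i)
    (hm_min : ∀ i, ∃ k ∈ Λ, k i = m i)
    (hirr : Irreducible (assocPoly Λ c m))
    -- minimality of ψ for S: no nonzero trigonometric polynomial with coefficient support
    -- a proper subset of Λ vanishes identically on S
    (hminimal : ∀ Λ' : Finset (Fin n → ℤ), Λ' ⊂ Λ → ∀ c' : Λ' → ℂ,
      (∀ x ∈ zeroSet Λ c, trigPoly Λ' c' x = 0) → c' = 0)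
    -- `0 < H^{n-1}(S) < ∞`
    (hS0 : 0 < μH[(n : ℝ) - 1] (zeroSet Λ c))
    (hS1 : μH[(n : ℝ) - 1] (zeroSet Λ c) < ⊤)
    (hN : Λ.card - 1 ≤ N) :
    ∀ᵐ x ∂(Measure.pi fun _ : Fin N =>
        (μH[(n : ℝ) - 1] (zeroSet Λ c))⁻¹ • (μH[(n : ℝ) - 1]).restrict (zeroSet Λ c)),
      (featureMatrix Λ x).rank = Λ.card - 1 := by
  classical
  set S := zeroSet Λ c with hSdef
  set μ : Measure (Fin n → ℝ) := (μH[(n : ℝ) - 1] S)⁻¹ • (μH[(n : ℝ) - 1]).restrict S with hμ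
  have hmeas : MeasurableSet S := by
    have h1 : MeasurableSet {x : Fin n → ℝ | ∀ i, 0 ≤ x i ∧ x i < 1} := by measurability
    have h2 : IsClosed {x : Fin n → ℝ | trigPoly Λ c x = 0} := by
      apply isClosed_eq _ continuous_const
      unfold trigPoly
      exact continuous_finsetSum _ fun k _ =>
        continuous_const.mul ((continuous_apply k).comp (phi_continuous Λ))
    exact h1.inter h2.measurableSet
  have hfin1 : IsFiniteMeasure ((μH[(n : ℝ) - 1] : Measure (Fin n → ℝ)).restrict S) :=
    ⟨by rw [Measure.restrict_apply_univ]; exact hS1⟩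
  have hfin : IsFiniteMeasure μ :=
    Measure.smul_finite _ (ENNReal.inv_ne_top.2 hS0.ne')
  have hac : μ ≪ (μH[(n : ℝ) - 1]).restrict S := Measure.smul_absolutelyContinuous
  have hcard : 0 < Λ.card := by
    obtain ⟨k, hk, _⟩ := hm_min ⟨0, hn⟩
    exact Finset.card_pos.2 ⟨k, hk⟩
  have hS : ∀ᵐ y ∂μ, y ∈ S := hac.ae_le (ae_restrict_mem hmeas)
  have H : ∀ U : Submodule ℂ (Λ → ℂ), Module.finrank ℂ U < Λ.card - 1 →
      FiniteDimensional ℂ U → ∀ᵐ y ∂μ, phiMap Λ y ∉ U := by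
    intro U hU _
    obtain ⟨q, hq, hqU⟩ := exists_ann U c (by simp; omega)
    have h0 := geom hn Λ c q m hfull hm_lb hirr hq
    have h1 : ∀ᵐ y ∂((μH[(n : ℝ) - 1] : Measure (Fin n → ℝ)).restrict S), trigPoly Λ q y ≠ 0 := by
      rw [ae_restrict_iff' hmeas, ae_iff]
      refine measure_mono_null ?_ h0
      intro x hx
      simpa using hx
    filter_upwards [hac.ae_le h1] with y hy hyU
    exact hy (hqU _ hyU)
  obtain ⟨e, he⟩ := ae_extend μ _ N hN _
    (ae_li (phiMap Λ) (phi_continuous Λ) μ (Λ.card - 1) H (Λ.card - 1) le_rfl)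
  have hall : ∀ᵐ x ∂(Measure.pi fun _ : Fin N => μ), ∀ i, x i ∈ S := by
    rw [ae_all_iff]
    intro i
    exact (Measure.quasiMeasurePreserving_eval (fun _ : Fin N => μ) i).ae hS
  filter_upwards [he, hall] with x hx hxS
  rw [Matrix.rank_eq_finrank_span_cols]
  set W := Submodule.span ℂ (Set.range (featureMatrix Λ x).col) with hW
  apply le_antisymm
  · have hlt : Module.finrank ℂ W < Module.finrank ℂ (Λ → ℂ) := by
      apply Submodule.finrank_lt
      intro htop
      let ℓ : (Λ → ℂ) →ₗ[ℂ] ℂ := ∑ k, c k • LinearMap.proj k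
      have hℓ : ∀ v, ℓ v = ∑ k, c k * v k := by intro v; simp [ℓ]
      have hle : W ≤ LinearMap.ker ℓ := by
        rw [hW, Submodule.span_le]
        rintro _ ⟨j, rfl⟩
        rw [SetLike.mem_coe, LinearMap.mem_ker, hℓ]
        exact (hxS j).2
      obtain ⟨k, hk⟩ := Function.ne_iff.1 hc
      have h1 : (Pi.single k 1 : Λ → ℂ) ∈ LinearMap.ker ℓ := hle (htop ▸ Submodule.mem_top)
      rw [LinearMap.mem_ker, hℓ] at h1
      simp [Pi.single_apply] at h1
      exact hk h1
    rw [Module.finrank_fintype_fun_eq_card, Fintype.card_coe] at hlt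
    omega
  · have h1 := finrank_span_eq_card hx
    rw [Fintype.card_fin] at h1
    rw [← h1]
    apply Submodule.finrank_mono
    apply Submodule.span_mono
    rintro _ ⟨i, rfl⟩
    exact ⟨e i, rfl⟩
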